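/- If G is a completely Hausdorff quasi-topological group, then EG is a completely Hausdorff quasi-topological space. -/

import Mathlib

/-! Statement 11: if `G` is a completely Hausdorff quasi-topological group, then `EG`
is a completely Hausdorff quasi-topological space. -/

universe u v w

/-- A family of "admissible" maps from compact Hausdorff test spaces into `X`. -/
def QFam (X : Type w) := ∀ K : CompHaus.{0}, Set (K → X)

/-- A quasi-topological space structure (Spanier): axioms (Q1)–(Q4). -/
structure QuasiTop (X : Type w) where
  Q : QFam X
  const_mem : ∀ (K : CompHaus.{0}) (x : X), (fun _ : K => x) ∈ Q K
  precomp_mem : ∀ (K₁ K₂ : CompHaus.{0}) (f : K₁ → K₂), Continuous f →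
    ∀ ψ ∈ Q K₂, ψ ∘ f ∈ Q K₁
  surj_mem : ∀ (K₁ K₂ : CompHaus.{0}) (f : K₁ → K₂), Continuous f → Function.Surjective f →
    ∀ ψ : K₂ → X, ψ ∘ f ∈ Q K₁ → ψ ∈ Q K₂
  sum_mem : ∀ (K₁ K₂ : CompHaus.{0}) (ψ : (CompHaus.of ((K₁ : Type) ⊕ (K₂ : Type))) → X),
    ψ ∘ Sum.inl ∈ Q K₁ → ψ ∘ Sum.inr ∈ Q K₂ → ψ ∈ Q (CompHaus.of ((K₁ : Type) ⊕ (K₂ : Type)))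

/-- Quasi-continuity of a map relative to given families of admissible maps. -/
def QuasiContinuous {X : Type w} {Y : Type v} (qX : QFam X) (qY : QFam Y) (f : X → Y) : Prop :=
  ∀ (K : CompHaus.{0}) (φ : K → X), φ ∈ qX K → f ∘ φ ∈ qY K

/-- The quasi-topology of a topological space. -/
def topQ (Z : Type w) [TopologicalSpace Z] : QFam Z := fun _K => {φ | Continuous φ}

/-- The quotient quasi-topology induced by a surjection `π : X → Y`. -/
def quotientQ {X : Type w} {Y : Type v} (qX : QFam X) (π : X → Y) : QFam Y :=
  fun K => {φ | ∃ (K' : CompHaus.{0}) (π' : K' → K) (φ' : K' → X),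
    Continuous π' ∧ Function.Surjective π' ∧ φ' ∈ qX K' ∧ π ∘ φ' = φ ∘ π'}

/-- The product quasi-topology. -/
def prodQ {ι : Type*} {X : ι → Type*} (q : ∀ i, QFam (X i)) : QFam (∀ i, X i) :=
  fun K => {φ | ∀ i, (fun k => φ k i) ∈ q i K}

/-- The binary product quasi-topology. -/
def prod2Q {X Y : Type*} (qX : QFam X) (qY : QFam Y) : QFam (X × Y) :=
  fun K => {φ | (fun k => (φ k).1) ∈ qX K ∧ (fun k => (φ k).2) ∈ qY K}

/-- The subspace quasi-topology. -/
def subspaceQ {X : Type*} (q : QFam X) (S : Set X) : QFam S :=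
  fun K => {φ | (fun k => (φ k : X)) ∈ q K}

/-- Completely Hausdorff quasi-topological space. -/
def QCompletelyHausdorff {X : Type*} (q : QFam X) : Prop :=
  ∀ x y : X, x ≠ y → ∃ f : X → unitInterval,
    QuasiContinuous q (topQ unitInterval) f ∧ f x = 0 ∧ f y = 1

/-- A quasi-topological group: multiplication and inversion are quasi-continuous. -/
structure QuasiTopGroup (G : Type w) [Group G] (qG : QuasiTop G) : Prop where
  mul_qc : QuasiContinuous (prod2Q qG.Q qG.Q) qG.Q (fun p => p.1 * p.2)
  inv_qc : QuasiContinuous qG.Q qG.Q (fun g => g⁻¹)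

/-- The setoid on `X × [0,1]` collapsing `X × {0}` to a point. -/
def coneSetoid (X : Type w) : Setoid (X × unitInterval) where
  r a b := a = b ∨ (a.2 = 0 ∧ b.2 = 0)
  iseqv := by
    refine ⟨fun a => Or.inl rfl, ?_, ?_⟩
    · rintro a b (rfl | ⟨h1, h2⟩)
      · exact Or.inl rfl
      · exact Or.inr ⟨h2, h1⟩
    · rintro a b c (rfl | ⟨h1, h2⟩) h
      · exact h
      · rcases h with rfl | ⟨h3, h4⟩
        · exact Or.inr ⟨h1, h2⟩
        · exact Or.inr ⟨h1, h4⟩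

/-- The unreduced cone of `X`, as a set: `(X × [0,1])/(X × {0})`. -/
def Cone (X : Type w) := Quotient (coneSetoid X)

/-- The canonical quotient map `X × [0,1] → con(X)`. -/
def conePt {X : Type w} (p : X × unitInterval) : Cone X := Quotient.mk (coneSetoid X) p

/-- The quotient quasi-topology on the cone, induced from the product quasi-topology
on `X × [0,1]`. -/
def coneQ {X : Type w} (q : QFam X) : QFam (Cone X) :=
  quotientQ (prod2Q q (topQ unitInterval)) conePt

/-- The coordinate map `t : con(X) → [0,1]`, `[(x, s)] ↦ s`. -/
def coneT {X : Type w} : Cone X → unitInterval :=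
  Quotient.lift (fun p => p.2) fun _a _b h =>
    Or.elim h (fun h => by rw [h]) (fun h => h.1.trans h.2.symm)

/-- The coordinate map `x : t⁻¹((0,1]) → X`, `[(x, s)] ↦ x`. -/
noncomputable def coneX {X : Type w} (c : {c : Cone X // coneT c ≠ 0}) : X :=
  (Quotient.out c.1).1

/-- The underlying set of the (modified) Milnor space `EG`:
sequences `[(t_j, g_j)]_j` in `con(G)^ℕ` with `Σ_j t_j = 1`. -/
def EGSet (G : Type w) : Set (ℕ → Cone G) :=
  {e | HasSum (fun j => (coneT (e j) : ℝ)) 1}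

/-- The quasi-topology of `EG`: subspace of the product quasi-topology on `con(G)^ℕ`. -/
def egQ {G : Type w} (q : QFam G) : QFam (EGSet G) :=
  subspaceQ (prodQ fun _ : ℕ => coneQ q) (EGSet G)

/-- The coordinate map `t_i : EG → [0,1]`. -/
def egT {G : Type w} (i : ℕ) (e : EGSet G) : unitInterval := coneT (e.1 i)

/-- The coordinate map `g_i : t_i⁻¹((0,1]) → G`. -/
noncomputable def egG {G : Type w} (i : ℕ) (e : {e : EGSet G // egT i e ≠ 0}) : G :=
  coneX ⟨e.1.1 i, e.2⟩

/-- A map out of a quotient into a topological space is quasi-continuous as soon as its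
composite with the quotient map is. -/
theorem QuasiContinuous.of_comp_quotient {X : Type w} {Y : Type v} {Z : Type*}
    [TopologicalSpace Z] {q : QFam X} {π : X → Y} {f : Y → Z}
    (hf : QuasiContinuous q (topQ Z) (f ∘ π)) :
    QuasiContinuous (quotientQ q π) (topQ Z) f := by
  rintro K φ ⟨K', π', φ', hc, hs, hφ', h⟩
  have hq : Topology.IsQuotientMap π' := hc.isClosedMap.isQuotientMap hc hs
  have hcomp : Continuous ((f ∘ π) ∘ φ') := hf K' φ' hφ'
  rw [Function.comp_assoc, h] at hcomp
  exact hq.continuous_iff.2 hcomp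

/-- Two distinct points of the unit interval are sent to `0` and `1` by a continuous self-map. -/
theorem unitInterval.exists_continuous_zero_one {a b : unitInterval} (hab : a ≠ b) :
    ∃ r : unitInterval → unitInterval, Continuous r ∧ r a = 0 ∧ r b = 1 := by
  have hd : dist b a ≠ 0 := dist_ne_zero.2 hab.symm
  refine ⟨fun z => Set.projIcc 0 1 zero_le_one (dist z a / dist b a), ?_, ?_, ?_⟩
  · exact continuous_projIcc.comp (by fun_prop)
  · simp
  · simp [div_self hd]

/-- Complete Hausdorffness only requires quasi-continuous functions taking distinct values. -/
theorem QCompletelyHausdorff.of_separating {X : Type*} {q : QFam X}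
    (h : ∀ x y : X, x ≠ y → ∃ f : X → unitInterval,
      QuasiContinuous q (topQ unitInterval) f ∧ f x ≠ f y) :
    QCompletelyHausdorff q := by
  intro x y hxy
  obtain ⟨f, hf, hne⟩ := h x y hxy
  obtain ⟨r, hr, h0, h1⟩ := unitInterval.exists_continuous_zero_one hne
  exact ⟨r ∘ f, fun K φ hφ => hr.comp (hf K φ hφ), h0, h1⟩

/-- The function `[(x, s)] ↦ f x * s` on the cone. -/
def coneMul {X : Type w} (f : X → unitInterval) : Cone X → unitInterval :=
  Quotient.lift (fun p => f p.1 * p.2) fun a b h => by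
    rcases h with rfl | ⟨ha, hb⟩
    · rfl
    · simp [ha, hb]

theorem quasiContinuous_coneT {X : Type w} (q : QFam X) :
    QuasiContinuous (coneQ q) (topQ unitInterval) coneT :=
  QuasiContinuous.of_comp_quotient fun _ _ hφ => hφ.2

theorem quasiContinuous_coneMul {X : Type w} {q : QFam X} {f : X → unitInterval}
    (hf : QuasiContinuous q (topQ unitInterval) f) :
    QuasiContinuous (coneQ q) (topQ unitInterval) (coneMul f) :=
  QuasiContinuous.of_comp_quotient fun K _ hφ => Continuous.mul (hf K _ hφ.1) hφ.2

/-- The cone on a completely Hausdorff space is completely Hausdorff. -/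
theorem QCompletelyHausdorff.cone {X : Type w} {q : QFam X} (h : QCompletelyHausdorff q) :
    QCompletelyHausdorff (coneQ q) := by
  refine .of_separating fun c d hcd => ?_
  by_cases ht : coneT c = coneT d
  · induction c using Quotient.inductionOn with | _ c
    induction d using Quotient.inductionOn with | _ d
    obtain ⟨x, s⟩ := c
    obtain ⟨y, t⟩ := d
    obtain rfl : s = t := ht
    have hs : s ≠ 0 := fun hs => hcd (Quotient.sound (Or.inr ⟨hs, hs⟩))
    have hxy : x ≠ y := by
      rintro rfl
      exact hcd rfl
    obtain ⟨f, hf, h0, h1⟩ := h x y hxy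
    refine ⟨coneMul f, quasiContinuous_coneMul hf, ?_⟩
    change f x * s ≠ f y * s
    simpa [h0, h1] using hs.symm
  · exact ⟨coneT, quasiContinuous_coneT q, ht⟩

/-- An arbitrary product of completely Hausdorff spaces is completely Hausdorff. -/
theorem QCompletelyHausdorff.prod {ι : Type*} {X : ι → Type*} {q : ∀ i, QFam (X i)}
    (h : ∀ i, QCompletelyHausdorff (q i)) : QCompletelyHausdorff (prodQ q) := by
  intro x y hxy
  obtain ⟨i, hi⟩ := Function.ne_iff.1 hxy
  obtain ⟨f, hf, h0, h1⟩ := h i _ _ hi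
  exact ⟨fun z => f (z i), fun K φ hφ => hf K _ (hφ i), h0, h1⟩

/-- A subspace of a completely Hausdorff space is completely Hausdorff. -/
theorem QCompletelyHausdorff.subspace {X : Type*} {q : QFam X} (h : QCompletelyHausdorff q)
    (S : Set X) : QCompletelyHausdorff (subspaceQ q S) := by
  intro x y hxy
  obtain ⟨f, hf, h0, h1⟩ := h x y (Subtype.coe_injective.ne hxy)
  exact ⟨fun z => f z, fun K φ hφ => hf K _ hφ, h0, h1⟩

theorem stmt_11 {G : Type u} [Group G] (qG : QuasiTop G) (hG : QuasiTopGroup G qG)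
    (hch : QCompletelyHausdorff qG.Q) :
    QCompletelyHausdorff (egQ qG.Q) := by
  exact (QCompletelyHausdorff.prod fun _ => hch.cone).subspace (EGSet G)
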